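/- Let m ≥ 2, β ∈ (0,1), γ ∈ (1,2), ω₁ > 0, ω₂ > 0, and let d_i^+, d_i^-, e_i^+, e_i^- ≥ 0 (i = 1,…,m−1) be nonnegative reals, with D_± = diag(d_i^±) and E_± = diag(e_i^±). Set A = ω₁(D_+ G_β + D_- G_βᵀ) − ω₂(E_+ G_γ + E_- G_γᵀ). Then the matrix I + A has strictly positive diagonal entries, nonpositive off-diagonal entries, and is strictly diagonally dominant by rows: for each row i, (I + A)_{i,i} − ∑_{j ≠ i} |(I + A)_{i,j}| ≥ 1 > 0. In particular, I + A is invertible, so the linear system (I + A)u = b has a unique solution for every right-hand side b. -/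

import Mathlib

open Matrix


/-- Grünwald coefficient `g_j^(s) = ((-1)^j / j!) * s(s-1)⋯(s-j+1)` (with `g_0 = 1`). -/
noncomputable def grunwald (s : ℝ) (j : ℕ) : ℝ :=
  (-1) ^ j / (Nat.factorial j : ℝ) * ∏ i ∈ Finset.range j, (s - i)

/-- The `(m-1)×(m-1)` lower-triangular Toeplitz matrix `G_β`. -/
noncomputable def Gbeta (β : ℝ) (m : ℕ) : Matrix (Fin (m - 1)) (Fin (m - 1)) ℝ :=
  fun i j => if (j : ℕ) ≤ (i : ℕ) then grunwald β ((i : ℕ) - (j : ℕ)) else 0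

/-- The `(m-1)×(m-1)` Toeplitz matrix `G_γ`. -/
noncomputable def Ggamma (γ : ℝ) (m : ℕ) : Matrix (Fin (m - 1)) (Fin (m - 1)) ℝ :=
  fun i j => if (j : ℕ) ≤ (i : ℕ) + 1 then grunwald γ ((i : ℕ) + 1 - (j : ℕ)) else 0

theorem grunwald_zero (s : ℝ) : grunwald s 0 = 1 := by simp [grunwald]

theorem grunwald_succ (s : ℝ) (j : ℕ) :
    grunwald s (j + 1) = grunwald s j * ((j - s) / (j + 1)) := by
  have h : (j.factorial : ℝ) ≠ 0 := by positivity
  rw [grunwald, grunwald, Finset.prod_range_succ, Nat.factorial_succ]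
  push_cast
  field_simp
  ring

theorem grunwald_succ_eq_sub_one (s : ℝ) (j : ℕ) :
    grunwald s (j + 1) = -(s / (j + 1)) * grunwald (s - 1) j := by
  have h : (j.factorial : ℝ) ≠ 0 := by positivity
  have hp : ∏ i ∈ Finset.range j, (s - ((i + 1 : ℕ) : ℝ)) =
      ∏ i ∈ Finset.range j, (s - 1 - i) :=
    Finset.prod_congr rfl fun i _ => by push_cast; ring
  rw [grunwald, grunwald, Finset.prod_range_succ', hp, Nat.factorial_succ]
  push_cast
  field_simp
  ring

theorem sum_range_grunwald (s : ℝ) (n : ℕ) :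
    ∑ j ∈ Finset.range (n + 1), grunwald s j = grunwald (s - 1) n := by
  induction n with
  | zero => simp [grunwald_zero]
  | succ n ih =>
    rw [Finset.sum_range_succ, ih, grunwald_succ_eq_sub_one, grunwald_succ]
    field_simp
    ring

theorem grunwald_nonneg_of_nonpos {s : ℝ} (hs : s ≤ 0) (j : ℕ) : 0 ≤ grunwald s j := by
  induction j with
  | zero => simp [grunwald_zero]
  | succ j ih =>
    rw [grunwald_succ]
    have : 0 ≤ (j : ℝ) - s := by linarith [Nat.cast_nonneg (α := ℝ) j]
    positivity

theorem grunwald_succ_nonpos {s : ℝ} (h0 : 0 ≤ s) (h1 : s ≤ 1) (j : ℕ) :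
    grunwald s (j + 1) ≤ 0 := by
  rw [grunwald_succ_eq_sub_one, neg_mul, neg_nonpos]
  exact mul_nonneg (by positivity) (grunwald_nonneg_of_nonpos (by linarith) j)

theorem grunwald_nonneg_of_ne_one {s : ℝ} (h1 : 1 ≤ s) (h2 : s ≤ 2) {j : ℕ} (hj : j ≠ 1) :
    0 ≤ grunwald s j := by
  match j, hj with
  | 0, _ => simp [grunwald_zero]
  | j + 2, _ =>
    rw [grunwald_succ_eq_sub_one, neg_mul, ← mul_neg]
    have := grunwald_succ_nonpos (s := s - 1) (by linarith) (by linarith) j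
    exact mul_nonneg (by positivity) (by linarith)

theorem sum_range_ite_le_sub {R : Type*} [AddCommMonoid R] (f : ℕ → R) {a n : ℕ} (h : a < n) :
    ∑ j ∈ Finset.range n, (if j ≤ a then f (a - j) else 0) = ∑ j ∈ Finset.range (a + 1), f j := by
  rw [← Finset.sum_filter, ← Finset.sum_range_reflect f]
  refine Finset.sum_congr ?_ fun j _ => by congr 1
  ext j
  simp only [Finset.mem_filter, Finset.mem_range]
  omega

theorem sum_range_ite_ge_sub {R : Type*} [AddCommMonoid R] (f : ℕ → R) {a n : ℕ} (h : a ≤ n) :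
    ∑ j ∈ Finset.range n, (if a ≤ j then f (j - a) else 0) = ∑ j ∈ Finset.range (n - a), f j := by
  obtain ⟨k, rfl⟩ := Nat.exists_eq_add_of_le h
  rw [Finset.sum_range_add, Finset.sum_eq_zero, zero_add]
  · simp
  · intro j hj
    rw [if_neg (by simpa using hj)]

theorem Gbeta_nonpos_of_ne {β : ℝ} (h0 : 0 ≤ β) (h1 : β ≤ 1) {m : ℕ}
    {i j : Fin (m - 1)} (hij : i ≠ j) : Gbeta β m i j ≤ 0 := by
  have hij' : (i : ℕ) ≠ j := Fin.val_ne_of_ne hij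
  unfold Gbeta
  split_ifs with h
  · obtain ⟨k, hk⟩ : ∃ k, (i : ℕ) - j = k + 1 := ⟨(i : ℕ) - j - 1, by omega⟩
    rw [hk]
    exact grunwald_succ_nonpos h0 h1 k
  · exact le_rfl

theorem sum_Gbeta_row_nonneg {β : ℝ} (h1 : β ≤ 1) {m : ℕ}
    (i : Fin (m - 1)) : 0 ≤ ∑ j, Gbeta β m i j := by
  unfold Gbeta
  rw [Fin.sum_univ_eq_sum_range
    (fun j => if j ≤ (i : ℕ) then grunwald β ((i : ℕ) - j) else 0),
    sum_range_ite_le_sub _ i.isLt, sum_range_grunwald]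
  exact grunwald_nonneg_of_nonpos (by linarith) _

theorem sum_Gbeta_col_nonneg {β : ℝ} (h1 : β ≤ 1) {m : ℕ}
    (i : Fin (m - 1)) : 0 ≤ ∑ j, Gbeta β m j i := by
  unfold Gbeta
  rw [Fin.sum_univ_eq_sum_range
    (fun j => if (i : ℕ) ≤ j then grunwald β (j - (i : ℕ)) else 0),
    sum_range_ite_ge_sub _ i.isLt.le]
  obtain ⟨k, hk⟩ : ∃ k, m - 1 - (i : ℕ) = k + 1 := ⟨m - 1 - i - 1, by omega⟩
  rw [hk, sum_range_grunwald]
  exact grunwald_nonneg_of_nonpos (by linarith) _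

theorem Ggamma_nonneg_of_ne {γ : ℝ} (h1 : 1 ≤ γ) (h2 : γ ≤ 2) {m : ℕ}
    {i j : Fin (m - 1)} (hij : i ≠ j) : 0 ≤ Ggamma γ m i j := by
  have hij' : (i : ℕ) ≠ j := Fin.val_ne_of_ne hij
  unfold Ggamma
  split_ifs with h
  · exact grunwald_nonneg_of_ne_one h1 h2 (by omega)
  · exact le_rfl

theorem sum_range_grunwald_nonpos {γ : ℝ} (h1 : 1 ≤ γ) (h2 : γ ≤ 2)
    (n : ℕ) :
    ∑ j ∈ Finset.range (n + 2), grunwald γ j ≤ 0 := by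
  rw [sum_range_grunwald]
  exact grunwald_succ_nonpos (by linarith) (by linarith) n

theorem sum_Ggamma_row_nonpos {γ : ℝ} (h1 : 1 ≤ γ) (h2 : γ ≤ 2) {m : ℕ}
    (i : Fin (m - 1)) : ∑ j, Ggamma γ m i j ≤ 0 := by
  unfold Ggamma
  rw [Fin.sum_univ_eq_sum_range
    (fun j => if j ≤ (i : ℕ) + 1 then grunwald γ ((i : ℕ) + 1 - j) else 0)]
  have h := sum_range_ite_le_sub (grunwald γ) (Nat.succ_lt_succ i.isLt)
  rw [Finset.sum_range_succ] at h
  have hlast : 0 ≤ if m - 1 ≤ (i : ℕ) + 1 then grunwald γ ((i : ℕ) + 1 - (m - 1)) else 0 := by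
    split_ifs
    · exact grunwald_nonneg_of_ne_one h1 h2 (by omega)
    · exact le_rfl
  linarith [sum_range_grunwald_nonpos h1 h2 i]

theorem sum_Ggamma_col_nonpos {γ : ℝ} (h1 : 1 ≤ γ) (h2 : γ ≤ 2) {m : ℕ}
    (i : Fin (m - 1)) : ∑ j, Ggamma γ m j i ≤ 0 := by
  unfold Ggamma
  rw [Fin.sum_univ_eq_sum_range
    (fun j => if (i : ℕ) ≤ j + 1 then grunwald γ (j + 1 - (i : ℕ)) else 0)]
  have h := sum_range_ite_ge_sub (grunwald γ) (Nat.le_succ_of_le i.isLt.le)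
  rw [Finset.sum_range_succ'] at h
  have hfirst : 0 ≤ if (i : ℕ) ≤ 0 then grunwald γ (0 - (i : ℕ)) else 0 := by
    split_ifs
    · exact grunwald_nonneg_of_ne_one h1 h2 (by omega)
    · exact le_rfl
  obtain ⟨k, hk⟩ : ∃ k, (m - 1).succ - (i : ℕ) = k + 2 := ⟨m - 1 - i - 1, by omega⟩
  rw [hk] at h
  linarith [sum_range_grunwald_nonpos h1 h2 k]

theorem diag_sub_sum_abs_eq_row_sum {ι : Type*} [Fintype ι] [DecidableEq ι] {M : Matrix ι ι ℝ}
    (hM : ∀ i j, i ≠ j → M i j ≤ 0) (i : ι) :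
    M i i - ∑ j ∈ Finset.univ.erase i, |M i j| = ∑ j, M i j := by
  rw [← Finset.add_sum_erase _ _ (Finset.mem_univ i), sub_eq_add_neg, ← Finset.sum_neg_distrib]
  congr 1
  refine Finset.sum_congr rfl fun j hj => ?_
  rw [abs_of_nonpos (hM i j (Finset.ne_of_mem_erase hj).symm), neg_neg]

theorem stmt15 (m : ℕ) (hm : 2 ≤ m) (β γ ω₁ ω₂ : ℝ)
    (hβ : β ∈ Set.Ioo (0 : ℝ) 1) (hγ : γ ∈ Set.Ioo (1 : ℝ) 2)
    (hω₁ : 0 < ω₁) (hω₂ : 0 < ω₂)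
    (dp dm ep em : Fin (m - 1) → ℝ)
    (hdp : ∀ i, 0 ≤ dp i) (hdm : ∀ i, 0 ≤ dm i)
    (hep : ∀ i, 0 ≤ ep i) (hem : ∀ i, 0 ≤ em i) :
    let A : Matrix (Fin (m - 1)) (Fin (m - 1)) ℝ :=
      ω₁ • (Matrix.diagonal dp * Gbeta β m + Matrix.diagonal dm * (Gbeta β m)ᵀ) -
        ω₂ • (Matrix.diagonal ep * Ggamma γ m + Matrix.diagonal em * (Ggamma γ m)ᵀ)
    let M : Matrix (Fin (m - 1)) (Fin (m - 1)) ℝ := 1 + A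
    (∀ i, 0 < M i i) ∧
    (∀ i j, i ≠ j → M i j ≤ 0) ∧
    (∀ i, 1 ≤ M i i - ∑ j ∈ Finset.univ.erase i, |M i j|) ∧
    IsUnit M ∧
    (∀ b : Fin (m - 1) → ℝ, ∃! u : Fin (m - 1) → ℝ, M.mulVec u = b) := by
  intro A M
  obtain ⟨hβ0, hβ1⟩ := hβ
  obtain ⟨hγ1, hγ2⟩ := hγ
  have hM : ∀ i j, M i j = (1 : Matrix (Fin (m - 1)) (Fin (m - 1)) ℝ) i j +
      (ω₁ * (dp i * Gbeta β m i j + dm i * Gbeta β m j i) -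
        ω₂ * (ep i * Ggamma γ m i j + em i * Ggamma γ m j i)) := by
    intro i j
    simp [M, A, Matrix.diagonal_mul, mul_add]
  have hoff : ∀ i j, i ≠ j → M i j ≤ 0 := by
    intro i j hij
    rw [hM, Matrix.one_apply_ne hij, zero_add, sub_nonpos]
    have hb : ω₁ * (dp i * Gbeta β m i j + dm i * Gbeta β m j i) ≤ 0 :=
      mul_nonpos_of_nonneg_of_nonpos hω₁.le (add_nonpos
        (mul_nonpos_of_nonneg_of_nonpos (hdp i) (Gbeta_nonpos_of_ne hβ0.le hβ1.le hij))
        (mul_nonpos_of_nonneg_of_nonpos (hdm i) (Gbeta_nonpos_of_ne hβ0.le hβ1.le hij.symm)))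
    have hg : 0 ≤ ω₂ * (ep i * Ggamma γ m i j + em i * Ggamma γ m j i) :=
      mul_nonneg hω₂.le (add_nonneg
        (mul_nonneg (hep i) (Ggamma_nonneg_of_ne hγ1.le hγ2.le hij))
        (mul_nonneg (hem i) (Ggamma_nonneg_of_ne hγ1.le hγ2.le hij.symm)))
    exact hb.trans hg
  have hdom : ∀ i, 1 ≤ M i i - ∑ j ∈ Finset.univ.erase i, |M i j| := by
    intro i
    rw [diag_sub_sum_abs_eq_row_sum hoff]
    have hsum : ∑ j, M i j = 1 +
        (ω₁ * (dp i * ∑ j, Gbeta β m i j + dm i * ∑ j, Gbeta β m j i) -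
          ω₂ * (ep i * ∑ j, Ggamma γ m i j + em i * ∑ j, Ggamma γ m j i)) := by
      simp only [hM, Finset.sum_add_distrib, Finset.sum_sub_distrib, ← Finset.mul_sum]
      simp [Matrix.one_apply]
    have hb : 0 ≤ ω₁ * (dp i * ∑ j, Gbeta β m i j + dm i * ∑ j, Gbeta β m j i) :=
      mul_nonneg hω₁.le (add_nonneg
        (mul_nonneg (hdp i) (sum_Gbeta_row_nonneg hβ1.le i))
        (mul_nonneg (hdm i) (sum_Gbeta_col_nonneg hβ1.le i)))
    have hg : ω₂ * (ep i * ∑ j, Ggamma γ m i j + em i * ∑ j, Ggamma γ m j i) ≤ 0 :=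
      mul_nonpos_of_nonneg_of_nonpos hω₂.le (add_nonpos
        (mul_nonpos_of_nonneg_of_nonpos (hep i) (sum_Ggamma_row_nonpos hγ1.le hγ2.le i))
        (mul_nonpos_of_nonneg_of_nonpos (hem i) (sum_Ggamma_col_nonpos hγ1.le hγ2.le i)))
    linarith
  have hlt : ∀ i, ∑ j ∈ Finset.univ.erase i, |M i j| < M i i := fun i => by
    linarith [hdom i]
  have hdiag : ∀ i, 0 < M i i := fun i =>
    (Finset.sum_nonneg fun j _ => abs_nonneg (M i j)).trans_lt (hlt i)
  have hunit : IsUnit M := by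
    rw [Matrix.isUnit_iff_isUnit_det, isUnit_iff_ne_zero]
    refine det_ne_zero_of_sum_row_lt_diag fun i => ?_
    simpa only [Real.norm_eq_abs, abs_of_pos (hdiag i)] using hlt i
  exact ⟨hdiag, hoff, hdom, hunit,
    Function.bijective_iff_existsUnique _ |>.mp
      ⟨Matrix.mulVec_injective_iff_isUnit.mpr hunit, Matrix.mulVec_surjective_iff_isUnit.mpr hunit⟩⟩
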